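/- arXiv:2005.01135 — 6 statements merged into one kernel-verified Lean document; each statement's English description precedes it below -/
import Mathlib

section
/- If Γ ⊢ φ is derivable in the natural deduction calculus NIEL⁻, where Γ = φ₁, …, φₙ, then the formula (φ₁ ∧ … ∧ φₙ) → φ is a theorem of the Hilbert-style system IEL⁻ in the fragment {→, ∧, ○} (for empty Γ the conclusion is that φ itself is an IEL⁻ theorem). -/
namespace IELMinus

/-- Formulas in the fragment `{→, ∧, ○}`. -/
inductive Fml : Type
| atom : ℕ → Fml
| imp : Fml → Fml → Fml
| and : Fml → Fml → Fml
| circ : Fml → Fml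

/-- The Hilbert-style system IEL⁻ in the fragment `{→, ∧, ○}`:
the intuitionistic axioms for `→` and `∧`, normality
`○(φ→ψ) → (○φ → ○ψ)`, co-reflection `φ → ○φ`, and Modus Ponens. -/
inductive IELthm : Fml → Prop
| ax1 {φ ψ θ} : IELthm (.imp (.imp φ (.imp ψ θ)) (.imp (.imp φ ψ) (.imp φ θ)))
| ax2 {φ ψ} : IELthm (.imp φ (.imp ψ φ))
| ax3 {φ ψ} : IELthm (.imp φ (.imp ψ (.and φ ψ)))
| ax4l {φ ψ} : IELthm (.imp (.and φ ψ) φ)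
| ax4r {φ ψ} : IELthm (.imp (.and φ ψ) ψ)
| normality {φ ψ} : IELthm (.imp (.circ (.imp φ ψ)) (.imp (.circ φ) (.circ ψ)))
| coreflection {φ} : IELthm (.imp φ (.circ φ))
| mp {φ ψ} : IELthm (.imp φ ψ) → IELthm φ → IELthm ψ

/-- The natural deduction calculus NIEL⁻, deriving sequents `Γ ⊢ φ` where
`Γ` is a finite list of formulas.  The rule `circI2` is `○I₂`: from
`Γ ⊢ ○φ₁, …, Γ ⊢ ○φₙ` and `φ₁, …, φₙ ⊢ ψ` infer `Γ ⊢ ○ψ`. -/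
inductive NIEL : List Fml → Fml → Prop
| ax {Γ φ} : φ ∈ Γ → NIEL Γ φ
| impI {Γ φ ψ} : NIEL (φ :: Γ) ψ → NIEL Γ (.imp φ ψ)
| impE {Γ φ ψ} : NIEL Γ (.imp φ ψ) → NIEL Γ φ → NIEL Γ ψ
| andI {Γ φ ψ} : NIEL Γ φ → NIEL Γ ψ → NIEL Γ (.and φ ψ)
| andE1 {Γ φ ψ} : NIEL Γ (.and φ ψ) → NIEL Γ φ
| andE2 {Γ φ ψ} : NIEL Γ (.and φ ψ) → NIEL Γ ψ
| circI1 {Γ φ} : NIEL Γ φ → NIEL Γ (.circ φ)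
| circI2 {Γ : List Fml} {φs : List Fml} {ψ : Fml} :
    (∀ φ ∈ φs, NIEL Γ (.circ φ)) → NIEL φs ψ → NIEL Γ (.circ ψ)

/-- The conjunction `φ₁ ∧ … ∧ φₙ` of a nonempty list of formulas. -/
def bigAnd : Fml → List Fml → Fml
| φ, [] => φ
| φ, ψ :: Δ => .and φ (bigAnd ψ Δ)

/-- The formula corresponding to the sequent `Γ ⊢ φ`:
`(φ₁ ∧ … ∧ φₙ) → φ` for `Γ = φ₁, …, φₙ` nonempty, and `φ` itself for `Γ` empty. -/
def seqFml : List Fml → Fml → Fml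
| [], φ => φ
| ψ :: Δ, φ => .imp (bigAnd ψ Δ) φ

end IELMinus

namespace IELMinus

/-- Hilbert derivability from hypotheses. -/
inductive HD (Γ : List Fml) : Fml → Prop
| thm {φ} : IELthm φ → HD Γ φ
| hyp {φ} : φ ∈ Γ → HD Γ φ
| mp {φ ψ} : HD Γ (.imp φ ψ) → HD Γ φ → HD Γ ψ

theorem IELthm.self (φ : Fml) : IELthm (.imp φ φ) :=
  .mp (.mp .ax1 .ax2) (.ax2 (ψ := Fml.imp φ φ))

theorem HD.ded {Γ : List Fml} {φ ψ : Fml} (h : HD (φ :: Γ) ψ) : HD Γ (.imp φ ψ) := by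
  induction h with
  | thm h => exact .thm (.mp .ax2 h)
  | hyp h =>
    rcases List.mem_cons.1 h with rfl | h
    · exact .thm (IELthm.self _)
    · exact .mp (.thm .ax2) (.hyp h)
  | mp _ _ h1 h2 => exact .mp (.mp (.thm .ax1) h1) h2

theorem HD.toThm {φ : Fml} (h : HD [] φ) : IELthm φ := by
  induction h with
  | thm h => exact h
  | hyp h => cases h
  | mp _ _ h1 h2 => exact .mp h1 h2

theorem HD.cut {Γ Δ : List Fml} {φ : Fml} (h : HD Δ φ) (H : ∀ ψ ∈ Δ, HD Γ ψ) : HD Γ φ := by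
  induction h with
  | thm h => exact .thm h
  | hyp h => exact H _ h
  | mp _ _ h1 h2 => exact .mp h1 h2

theorem HD.circ {Γ Δ : List Fml} {φ : Fml} (h : HD Δ φ) (H : ∀ ψ ∈ Δ, HD Γ (.circ ψ)) :
    HD Γ (.circ φ) := by
  induction h with
  | thm h => exact .thm (.mp .coreflection h)
  | hyp h => exact H _ h
  | mp _ _ h1 h2 => exact .mp (.mp (.thm .normality) h1) h2

theorem NIEL.toHD {Γ : List Fml} {φ : Fml} (h : NIEL Γ φ) : HD Γ φ := by
  induction h with
  | ax h => exact .hyp h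
  | impI _ h => exact h.ded
  | impE _ _ h1 h2 => exact .mp h1 h2
  | andI _ _ h1 h2 => exact .mp (.mp (.thm .ax3) h1) h2
  | andE1 _ h => exact .mp (.thm .ax4l) h
  | andE2 _ h => exact .mp (.thm .ax4r) h
  | circI1 _ h => exact .mp (.thm .coreflection) h
  | circI2 _ _ h1 h2 => exact h2.circ h1

theorem HD.bigAnd {Γ : List Fml} (Δ : List Fml) : ∀ (φ : Fml), HD Γ (bigAnd φ Δ) →
    ∀ ψ ∈ φ :: Δ, HD Γ ψ := by
  induction Δ with
  | nil =>
    intro φ h ψ hψ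
    rw [List.mem_singleton] at hψ
    subst hψ
    exact h
  | cons θ Δ ih =>
    intro φ h ψ hψ
    rcases List.mem_cons.1 hψ with rfl | hψ
    · exact .mp (.thm .ax4l) h
    · exact ih θ (.mp (.thm .ax4r) h) ψ hψ

end IELMinus

open IELMinus in
/-- If `Γ ⊢ φ` is derivable in NIEL⁻, then `(φ₁ ∧ … ∧ φₙ) → φ` is a theorem of
IEL⁻ (in the fragment `{→, ∧, ○}`), where `Γ = φ₁, …, φₙ`; for empty `Γ` the
conclusion is that `φ` itself is an IEL⁻ theorem. -/
theorem NIEL_to_IEL {Γ : List Fml} {φ : Fml} (h : NIEL Γ φ) :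
    IELthm (seqFml Γ φ) := by
  cases Γ with
  | nil => exact h.toHD.toThm
  | cons ψ Δ =>
    exact (h.toHD.cut (HD.bigAnd Δ ψ (.hyp (List.mem_singleton.2 rfl)))).ded.toThm
end

section
/- Let (P, ≤, ▷) be a localic cover system and define j X = {x ∈ P | ∃ C, x ▷ C and C ⊆ X}. Then j is multiplicative on up-sets: for all up-sets X, Y ⊆ P, j(X ∩ Y) = j X ∩ j Y; consequently j is a nucleus on the locale of up-sets of P. -/
/-- `upClo A = ↑A = {x | ∃ y ∈ A, y ≤ x}`. -/
def upClo {P : Type*} [PartialOrder P] (A : Set P) : Set P :=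
  {x | ∃ y ∈ A, y ≤ x}

/-- A cover system on a poset `P`: a relation `cov` (written `x ▷ C`) between
elements and subsets of `P` satisfying Existence, Transitivity and Refinement. -/
structure CoverSystem (P : Type*) [PartialOrder P] where
  cov : P → Set P → Prop
  exists_cover : ∀ x : P, ∃ C, cov x C ∧ C ⊆ Set.Ici x
  transitivity : ∀ (x : P) (C : Set P) (f : P → Set P),
    cov x C → (∀ y ∈ C, cov y (f y)) → cov x (⋃ y ∈ C, f y)
  refinement : ∀ (x y : P) (C : Set P), x ≤ y → cov x C →
    ∃ C', cov y C' ∧ C' ⊆ upClo C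

/-- A cover system is localic if every `x`-cover can be refined to an
`x`-cover included in `↑x`. -/
def CoverSystem.Localic {P : Type*} [PartialOrder P] (S : CoverSystem P) : Prop :=
  ∀ (x : P) (C : Set P), S.cov x C →
    ∃ C', S.cov x C' ∧ C' ⊆ upClo C ∧ C' ⊆ Set.Ici x

/-- The operator `j X = {x | ∃ C, x ▷ C and C ⊆ X}` of a cover system. -/
def CoverSystem.j {P : Type*} [PartialOrder P] (S : CoverSystem P) (X : Set P) : Set P :=
  {x | ∃ C, S.cov x C ∧ C ⊆ X}

/-- For a localic cover system, `j` is multiplicative on up-sets: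
`j (X ∩ Y) = j X ∩ j Y`; consequently (together with being inflationary,
idempotent and preserving up-sets) `j` is a nucleus on the locale of up-sets. -/
theorem localic_coverSystem_j_nucleus {P : Type*} [PartialOrder P]
    (S : CoverSystem P) (hS : S.Localic)
    (X Y : Set P) (hX : IsUpperSet X) (hY : IsUpperSet Y) :
    S.j (X ∩ Y) = S.j X ∩ S.j Y ∧
    IsUpperSet (S.j X) ∧ X ⊆ S.j X ∧ S.j (S.j X) ⊆ S.j X := by
  classical
  have up : ∀ {Z : Set P}, IsUpperSet Z → IsUpperSet (S.j Z) := by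
    rintro Z hZ x y hxy ⟨C, hC, hCZ⟩
    obtain ⟨C', hC', hs⟩ := S.refinement x y C hxy hC
    refine ⟨C', hC', fun z hz => ?_⟩
    obtain ⟨w, hw, hwz⟩ := hs hz
    exact hZ hwz (hCZ hw)
  have loc : ∀ {Z : Set P}, IsUpperSet Z → ∀ x ∈ S.j Z,
      ∃ C, S.cov x C ∧ C ⊆ Z ∧ C ⊆ Set.Ici x := by
    rintro Z hZ x ⟨C, hC, hCZ⟩
    obtain ⟨C', hC', hs, hI⟩ := hS x C hC
    refine ⟨C', hC', fun z hz => ?_, hI⟩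
    obtain ⟨w, hw, hwz⟩ := hs hz
    exact hZ hwz (hCZ hw)
  have idem : ∀ Z : Set P, S.j (S.j Z) ⊆ S.j Z := by
    rintro Z x ⟨C, hC, hCZ⟩
    have h : ∀ y, ∃ D, y ∈ C → S.cov y D ∧ D ⊆ Z := by
      intro y
      by_cases hy : y ∈ C
      · obtain ⟨D, hD⟩ := hCZ hy
        exact ⟨D, fun _ => hD⟩
      · exact ⟨∅, fun h => absurd h hy⟩
    choose f hf using h
    exact ⟨_, S.transitivity x C f hC (fun y hy => (hf y hy).1),
      Set.iUnion₂_subset fun y hy => (hf y hy).2⟩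
  refine ⟨Set.Subset.antisymm ?_ ?_, up hX, ?_, idem X⟩
  · rintro x ⟨C, hC, hs⟩
    exact ⟨⟨C, hC, fun z hz => (hs hz).1⟩, ⟨C, hC, fun z hz => (hs hz).2⟩⟩
  · rintro x ⟨hx, hy⟩
    obtain ⟨C, hC, hCX, hCI⟩ := loc hX x hx
    refine idem _ ⟨C, hC, fun y hyC => ?_⟩
    obtain ⟨D, hD, hDY, hDI⟩ := loc hY y (up hY (hCI hyC) hy)
    exact ⟨D, hD, fun z hz => ⟨hX (hDI hz) (hCX hyC), hDY hz⟩⟩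
  · intro x hx
    obtain ⟨C, hC, hI⟩ := S.exists_cover x
    exact ⟨C, hC, fun z hz => hX (hI hz) hx⟩
end

section
/- Representation of locales by cover systems: let L be a frame (complete Heyting algebra). Equip L with the reversed order x ⊑ y iff y ≤ x, and the covering relation x ▷ C iff x = sSup C. Then (L, ⊑, ▷) is a strictly localic cover system (it satisfies Existence, Transitivity and Refinement, and every x-cover is contained in the ⊑-cone of x, i.e. x ▷ C implies c ≤ x for all c ∈ C). Moreover, a subset X ⊆ L is a proposition of this cover system if and only if X = {y ∈ L | y ≤ a} for some a ∈ L, and the map a ↦ {y ∈ L | y ≤ a} is an order isomorphism from L onto the set of propositions ordered by inclusion. -/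
namespace FrameCover

variable {L : Type*} [Order.Frame L]

/-- The covering relation on a frame: `x ▷ C` iff `x = sSup C`. -/
def cov (x : L) (C : Set L) : Prop := x = sSup C

/-- The up-closure `↑A` with respect to the reversed order `⊑`
(`x ⊑ y` iff `y ≤ x`): `↑A = {x | ∃ y ∈ A, y ⊑ x} = {x | ∃ y ∈ A, x ≤ y}`. -/
def sqUpClo (A : Set L) : Set L := {x | ∃ y ∈ A, x ≤ y}

/-- `j X = {x | ∃ C, x ▷ C and C ⊆ X}`. -/
def j (X : Set L) : Set L := {x | ∃ C, cov x C ∧ C ⊆ X}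

/-- A proposition of the cover system `(L, ⊑, ▷)`: an up-set with respect to
`⊑` (i.e. a `≤`-downward-closed set) that is localised (`j X ⊆ X`). -/
def IsProp (X : Set L) : Prop := IsLowerSet X ∧ j X ⊆ X

end FrameCover

open FrameCover in
/-- Representation of locales by cover systems: on a frame `L` with the
reversed order `x ⊑ y ↔ y ≤ x` and covering `x ▷ C ↔ x = sSup C`,
the triple `(L, ⊑, ▷)` is a strictly localic cover system (Existence,
Transitivity, Refinement, and every `x`-cover lies in the `⊑`-cone of `x`);
moreover `X` is a proposition iff `X = {y | y ≤ a}` for some `a`, and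
`a ↦ {y | y ≤ a}` is an order isomorphism of `L` onto the propositions
ordered by inclusion. -/
theorem frame_cover_representation {L : Type*} [Order.Frame L] :
    -- Existence: every `x` has a cover contained in the `⊑`-cone of `x`
    (∀ x : L, ∃ C, cov x C ∧ ∀ c ∈ C, c ≤ x) ∧
    -- Transitivity
    (∀ (x : L) (C : Set L) (f : L → Set L), cov x C → (∀ y ∈ C, cov y (f y)) →
      cov x (⋃ y ∈ C, f y)) ∧
    -- Refinement (with respect to `⊑`: `x ⊑ y` means `y ≤ x`)
    (∀ x y : L, ∀ C : Set L, y ≤ x → cov x C →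
      ∃ C', cov y C' ∧ C' ⊆ sqUpClo C) ∧
    -- Strictness: every `x`-cover is included in `↑x = {c | c ≤ x}`
    (∀ (x : L) (C : Set L), cov x C → ∀ c ∈ C, c ≤ x) ∧
    -- Characterisation of the propositions
    (∀ X : Set L, IsProp X ↔ ∃ a : L, X = Set.Iic a) ∧
    -- `a ↦ Iic a` is an order isomorphism onto the propositions
    (∀ a b : L, Set.Iic a ⊆ Set.Iic b ↔ a ≤ b) := by
  refine ⟨?_, ?_, ?_, ?_, ?_, ?_⟩
  · intro x
    exact ⟨{x}, by simp [cov], by simp⟩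
  · intro x C f hx hf
    unfold cov at *
    subst hx
    apply le_antisymm
    · refine sSup_le fun y hy => ?_
      rw [hf y hy]
      exact sSup_le_sSup (Set.subset_biUnion_of_mem (u := f) hy)
    · refine sSup_le fun z hz => ?_
      simp only [Set.mem_iUnion, exists_prop] at hz
      obtain ⟨y, hy, hz⟩ := hz
      refine le_trans ?_ (le_sSup hy)
      rw [hf y hy]
      exact le_sSup hz
  · intro x y C hyx hx
    unfold cov at *
    refine ⟨(fun c => y ⊓ c) '' C, ?_, ?_⟩
    · rw [sSup_image, ← inf_sSup_eq, ← hx, inf_eq_left.mpr hyx]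
    · rintro _ ⟨c, hc, rfl⟩
      exact ⟨c, hc, inf_le_right⟩
  · intro x C hx c hc
    unfold cov at hx
    rw [hx]
    exact le_sSup hc
  · intro X
    constructor
    · rintro ⟨hl, hj⟩
      have hm : sSup X ∈ X := hj ⟨X, rfl, subset_rfl⟩
      exact ⟨sSup X, Set.Subset.antisymm (fun z hz => le_sSup hz) (fun z hz => hl hz hm)⟩
    · rintro ⟨a, rfl⟩
      refine ⟨isLowerSet_Iic a, ?_⟩
      rintro x ⟨C, hx, hC⟩
      unfold cov at hx
      rw [hx]
      exact sSup_le fun c hc => hC hc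
  · intro a b
    exact Set.Iic_subset_Iic
end

section
/- Prenuclei lift to Dedekind–MacNeille completions (upper extension): let H be a Heyting algebra, L a frame, and e : H → L an injective Heyting algebra homomorphism (preserving finite meets and Heyting implication) that is join-dense (every x ∈ L satisfies x = ⨆{e a | a ∈ H, e a ≤ x}) and meet-dense (every x ∈ L satisfies x = ⨅{e a | a ∈ H, x ≤ e a}). Let ι : H → H be monotone with a ≤ ι a and ι a ⊓ b ≤ ι(a ⊓ b) for all a, b ∈ H. Define ι•(x) = ⨅{e(ι a) | a ∈ H, x ≤ e a}. Then ι• is a prenucleus on L: ι• is monotone, x ≤ ι•(x) for all x ∈ L, and ι•(x) ⊓ y ≤ ι•(x ⊓ y) for all x, y ∈ L. -/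
/-- Prenuclei lift to Dedekind–MacNeille completions (upper extension):
let `H` be a Heyting algebra, `L` a frame, and `e : H → L` an injective
Heyting algebra homomorphism (preserving finite meets and Heyting
implication) which is join-dense and meet-dense in `L`.  If `ι : H → H` is a
prenucleus, then `ι• (x) = ⨅ {e (ι a) | a ∈ H, x ≤ e a}` is a prenucleus on
`L`: it is monotone, inflationary, and satisfies `ι• x ⊓ y ≤ ι• (x ⊓ y)`. -/
theorem prenucleus_upper_extension
    {H : Type*} [HeytingAlgebra H] {L : Type*} [Order.Frame L]
    (e : H → L)
    (he_inj : Function.Injective e)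
    (he_inf : ∀ a b : H, e (a ⊓ b) = e a ⊓ e b)
    (he_top : e ⊤ = ⊤)
    (he_himp : ∀ a b : H, e (a ⇨ b) = e a ⇨ e b)
    (he_join_dense : ∀ x : L, x = sSup {y | ∃ a : H, y = e a ∧ e a ≤ x})
    (he_meet_dense : ∀ x : L, x = sInf {y | ∃ a : H, y = e a ∧ x ≤ e a})
    (ι : H → H) (hι_mono : Monotone ι)
    (hι_infl : ∀ a : H, a ≤ ι a)
    (hι_pre : ∀ a b : H, ι a ⊓ b ≤ ι (a ⊓ b)) :
    Monotone (fun x : L => sInf {y | ∃ a : H, y = e (ι a) ∧ x ≤ e a}) ∧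
    (∀ x : L, x ≤ sInf {y | ∃ a : H, y = e (ι a) ∧ x ≤ e a}) ∧
    (∀ x y : L,
      sInf {z | ∃ a : H, z = e (ι a) ∧ x ≤ e a} ⊓ y ≤
        sInf {z | ∃ a : H, z = e (ι a) ∧ x ⊓ y ≤ e a}) := by
  have he_mono : Monotone e := by
    intro a b hab
    have h : e a = e a ⊓ e b := by rw [← he_inf, inf_eq_left.mpr hab]
    exact inf_eq_left.mp h.symm
  refine ⟨?_, ?_, ?_⟩
  · intro x y hxy
    apply sInf_le_sInf
    rintro z ⟨a, rfl, ha⟩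
    exact ⟨a, rfl, hxy.trans ha⟩
  · intro x
    apply le_sInf
    rintro z ⟨a, rfl, ha⟩
    exact ha.trans (he_mono (hι_infl a))
  · intro x y
    apply le_sInf
    rintro z ⟨a, rfl, ha⟩
    rw [inf_comm, ← le_himp_iff, he_join_dense y]
    apply sSup_le
    rintro w ⟨b, rfl, hb⟩
    rw [le_himp_iff, inf_comm]
    have h1 : x ≤ e (b ⇨ a) := by
      rw [he_himp, le_himp_iff]
      exact (inf_le_inf_left x hb).trans ha
    calc sInf {z | ∃ a : H, z = e (ι a) ∧ x ≤ e a} ⊓ e b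
        ≤ e (ι (b ⇨ a)) ⊓ e b := inf_le_inf_right _ (sInf_le ⟨_, rfl, h1⟩)
      _ = e (ι (b ⇨ a) ⊓ b) := (he_inf _ _).symm
      _ ≤ e (ι a) := he_mono ((hι_pre _ _).trans (hι_mono himp_inf_le))
end

section
/- Multiplicative prenuclei lift to Dedekind–MacNeille completions (lower extension): let H be a Heyting algebra, L a frame, and e : H → L an injective lattice homomorphism preserving finite meets that is join-dense (every x ∈ L satisfies x = ⨆{e a | a ∈ H, e a ≤ x}). Let ι : H → H be a multiplicative prenucleus, i.e. monotone with a ≤ ι a for all a and ι(a ⊓ b) = ι a ⊓ ι b for all a, b. Define ι°(x) = ⨆{e(ι a) | a ∈ H, e a ≤ x}. Then ι° is a multiplicative prenucleus on L: ι° is monotone, x ≤ ι°(x) for all x ∈ L, x ⊓ ι°(y) ≤ ι°(x ⊓ y) for all x, y ∈ L, and ι°(x ⊓ y) = ι°(x) ⊓ ι°(y) for all x, y ∈ L. -/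
/-- Multiplicative prenuclei lift to Dedekind–MacNeille completions (lower
extension): let `H` be a Heyting algebra, `L` a frame, and `e : H → L` an
injective lattice homomorphism preserving finite meets which is join-dense in
`L`.  If `ι : H → H` is a multiplicative prenucleus (monotone, inflationary,
`ι (a ⊓ b) = ι a ⊓ ι b`), then `ι° (x) = ⨆ {e (ι a) | a ∈ H, e a ≤ x}` is a
multiplicative prenucleus on `L`: it is monotone, inflationary, satisfies
`x ⊓ ι° y ≤ ι° (x ⊓ y)`, and `ι° (x ⊓ y) = ι° x ⊓ ι° y`. -/
theorem multiplicative_prenucleus_lower_extension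
    {H : Type*} [HeytingAlgebra H] {L : Type*} [Order.Frame L]
    (e : H → L)
    (he_inj : Function.Injective e)
    (he_inf : ∀ a b : H, e (a ⊓ b) = e a ⊓ e b)
    (he_sup : ∀ a b : H, e (a ⊔ b) = e a ⊔ e b)
    (he_top : e ⊤ = ⊤)
    (he_join_dense : ∀ x : L, x = sSup {y | ∃ a : H, y = e a ∧ e a ≤ x})
    (ι : H → H) (hι_mono : Monotone ι)
    (hι_infl : ∀ a : H, a ≤ ι a)
    (hι_mult : ∀ a b : H, ι (a ⊓ b) = ι a ⊓ ι b) :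
    Monotone (fun x : L => sSup {y | ∃ a : H, y = e (ι a) ∧ e a ≤ x}) ∧
    (∀ x : L, x ≤ sSup {y | ∃ a : H, y = e (ι a) ∧ e a ≤ x}) ∧
    (∀ x y : L,
      x ⊓ sSup {z | ∃ a : H, z = e (ι a) ∧ e a ≤ y} ≤
        sSup {z | ∃ a : H, z = e (ι a) ∧ e a ≤ x ⊓ y}) ∧
    (∀ x y : L,
      sSup {z | ∃ a : H, z = e (ι a) ∧ e a ≤ x ⊓ y} =
        sSup {z | ∃ a : H, z = e (ι a) ∧ e a ≤ x} ⊓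
          sSup {z | ∃ a : H, z = e (ι a) ∧ e a ≤ y}) := by
  have he_mono : ∀ a b : H, a ≤ b → e a ≤ e b := by
    intro a b h
    have h1 := he_inf a b
    rw [inf_eq_left.mpr h] at h1
    rw [h1]
    exact inf_le_right
  have mono : ∀ x y : L, x ≤ y → sSup {z | ∃ a : H, z = e (ι a) ∧ e a ≤ x} ≤
      sSup {z | ∃ a : H, z = e (ι a) ∧ e a ≤ y} := by
    intro x y h
    apply sSup_le_sSup
    rintro z ⟨a, rfl, ha⟩
    exact ⟨a, rfl, ha.trans h⟩
  have infl : ∀ x : L, x ≤ sSup {y | ∃ a : H, y = e (ι a) ∧ e a ≤ x} := by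
    intro x
    conv_lhs => rw [he_join_dense x]
    apply sSup_le
    rintro z ⟨a, rfl, ha⟩
    exact (he_mono _ _ (hι_infl a)).trans (le_sSup ⟨a, rfl, ha⟩)
  have mult : ∀ x y : L, sSup {z | ∃ a : H, z = e (ι a) ∧ e a ≤ x} ⊓
      sSup {z | ∃ a : H, z = e (ι a) ∧ e a ≤ y} ≤
      sSup {z | ∃ a : H, z = e (ι a) ∧ e a ≤ x ⊓ y} := by
    intro x y
    rw [sSup_inf_sSup]
    apply iSup₂_le
    rintro ⟨_, _⟩ ⟨⟨a, rfl, ha⟩, ⟨b, rfl, hb⟩⟩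
    refine le_sSup ⟨a ⊓ b, ?_, ?_⟩
    · rw [hι_mult, he_inf]
    · rw [he_inf]
      exact inf_le_inf ha hb
  refine ⟨fun x y h => mono x y h, infl, fun x y => ?_, fun x y => le_antisymm ?_ (mult x y)⟩
  · exact (inf_le_inf_right _ (infl x)).trans (mult x y)
  · exact le_inf (mono _ _ inf_le_left) (mono _ _ inf_le_right)
end

section
/- Let (P, ≤) be a partially ordered set and R a binary relation on P such that: R is serial (for every x there is y with x R y); if x R y and x R z then there exists w with y ≤ w, z ≤ w, and x R w; and whenever x R y there exists z with y ≤ z, x ≤ z, and x R z. Define ⟨R⟩A = {x ∈ P | ∃ y ∈ A, x R y}. Then ⟨R⟩ is a multiplicative prenucleus on up-sets: for all up-sets A, B ⊆ P, (i) ⟨R⟩(A ∩ B) = ⟨R⟩A ∩ ⟨R⟩B; (ii) A ∩ ⟨R⟩B ⊆ ⟨R⟩(A ∩ B); and (iii) ⟨R⟩P = P. -/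
/-- The operator `⟨R⟩A = {x | ∃ y ∈ A, x R y}`. -/
def diaRel {P : Type*} (R : P → P → Prop) (A : Set P) : Set P :=
  {x | ∃ y ∈ A, R x y}

/-- Let `(P, ≤)` be a poset and `R` a relation which is serial, directed
(`x R y` and `x R z` give `w` above `y` and `z` with `x R w`), and satisfies
the prenuclear condition (`x R y` gives `z` with `y ≤ z`, `x ≤ z`, `x R z`).
Then `⟨R⟩` is a multiplicative prenucleus on up-sets: for all up-sets `A, B`,
(i) `⟨R⟩(A ∩ B) = ⟨R⟩A ∩ ⟨R⟩B`; (ii) `A ∩ ⟨R⟩B ⊆ ⟨R⟩(A ∩ B)`; and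
(iii) `⟨R⟩P = P` (the top up-set is preserved). -/
theorem diaRel_multiplicative_prenucleus {P : Type*} [PartialOrder P]
    (R : P → P → Prop)
    (hserial : ∀ x : P, ∃ y, R x y)
    (hdir : ∀ x y z : P, R x y → R x z → ∃ w, y ≤ w ∧ z ≤ w ∧ R x w)
    (hpre : ∀ x y : P, R x y → ∃ z, y ≤ z ∧ x ≤ z ∧ R x z)
    (A B : Set P) (hA : IsUpperSet A) (hB : IsUpperSet B) :
    diaRel R (A ∩ B) = diaRel R A ∩ diaRel R B ∧
    A ∩ diaRel R B ⊆ diaRel R (A ∩ B) ∧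
    diaRel R (Set.univ : Set P) = Set.univ := by
  refine ⟨?_, ?_, ?_⟩
  · ext x
    constructor
    · rintro ⟨y, ⟨hyA, hyB⟩, hxy⟩
      exact ⟨⟨y, hyA, hxy⟩, ⟨y, hyB, hxy⟩⟩
    · rintro ⟨⟨y, hyA, hxy⟩, ⟨z, hzB, hxz⟩⟩
      obtain ⟨w, hyw, hzw, hxw⟩ := hdir x y z hxy hxz
      exact ⟨w, ⟨hA hyw hyA, hB hzw hzB⟩, hxw⟩
  · rintro x ⟨hxA, y, hyB, hxy⟩
    obtain ⟨z, hyz, hxz, hRz⟩ := hpre x y hxy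
    exact ⟨z, ⟨hA hxz hxA, hB hyz hyB⟩, hRz⟩
  · refine Set.eq_univ_of_forall fun x => ?_
    obtain ⟨y, hxy⟩ := hserial x
    exact ⟨y, Set.mem_univ y, hxy⟩
end
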